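/- Every color respecting automorphism γ of G induces a well-defined order automorphism γ̂ of P_G given by γ̂((C,v)) = (̄γ(C), γ(v)), where ̄γ is the permutation of R induced by γ; moreover the map μ : Γ_c(G) → Aut(P_G) sending γ to γ̂ is an injective group homomorphism. -/

import Mathlib

open SimpleGraph

variable {V R : Type*}

/-- The spanning subgraph of `G` keeping only the edges whose color lies in `C`. -/
def colorSub (G : SimpleGraph V) (c : V → V → R) (C : Finset R) : SimpleGraph V :=
  SimpleGraph.fromRel (fun a b => G.Adj a b ∧ c a b ∈ C)

/-- `v` and `w` are `C`-equivalent: joined by a walk all of whose edges have colors in `C`. -/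
def cEquiv (G : SimpleGraph V) (c : V → V → R) (C : Finset R) (v w : V) : Prop :=
  (colorSub G c C).Reachable v w

/-- `c` is a proper edge coloring of `G` such that at each vertex the colors of the incident
edges are pairwise distinct and exhaust the color set `R`
(so `G` is a properly edge-colored `|R|`-regular graph). -/
structure IsProperColoring (G : SimpleGraph V) (c : V → V → R) : Prop where
  symm : ∀ v w, G.Adj v w → c v w = c w v
  bijOn : ∀ v : V, Set.BijOn (fun w => c v w) (G.neighborSet v) Set.univ

/-- The preorder on pairs `(C, v)`. -/
def faceLE (G : SimpleGraph V) (c : V → V → R) (p q : Finset R × V) : Prop :=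
  p.1 ⊆ q.1 ∧ cEquiv G c q.1 p.2 q.2

/-- The identification `(C,v) = (D,w)` iff `C = D` and `v ∼_C w`. -/
def faceSetoid (G : SimpleGraph V) (c : V → V → R) : Setoid (Finset R × V) where
  r p q := p.1 = q.1 ∧ cEquiv G c p.1 p.2 q.2
  iseqv := by
    constructor
    · exact fun p => ⟨rfl, SimpleGraph.Reachable.refl _⟩
    · rintro p q ⟨h1, h2⟩
      refine ⟨h1.symm, ?_⟩
      rw [← h1]
      exact h2.symm
    · rintro p q u ⟨h1, h2⟩ ⟨h3, h4⟩
      refine ⟨h1.trans h3, h2.trans ?_⟩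
      rw [h1]
      exact h4

lemma colorSub_mono (G : SimpleGraph V) (c : V → V → R) {C D : Finset R} (h : C ⊆ D) :
    colorSub G c C ≤ colorSub G c D := by
  intro a b hab
  obtain ⟨hne, h'⟩ := hab
  exact ⟨hne, h'.imp (fun hx => ⟨hx.1, h hx.2⟩) (fun hx => ⟨hx.1, h hx.2⟩)⟩

lemma cEquiv_mono (G : SimpleGraph V) (c : V → V → R) {C D : Finset R} (h : C ⊆ D)
    {v w : V} (hvw : cEquiv G c C v w) : cEquiv G c D v w :=
  hvw.mono (colorSub_mono G c h)

/-- The faces of the colorful polytope `P_G`. -/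
def ColorfulFace (G : SimpleGraph V) (c : V → V → R) : Type _ :=
  Quotient (faceSetoid G c)

/-- The face of `P_G` represented by the pair `(C, v)`. -/
def mkFace (G : SimpleGraph V) (c : V → V → R) (C : Finset R) (v : V) : ColorfulFace G c :=
  Quotient.mk (faceSetoid G c) (C, v)

/-- The partial order of the colorful polytope `P_G`. -/
instance ColorfulFace.instPartialOrder (G : SimpleGraph V) (c : V → V → R) :
    PartialOrder (ColorfulFace G c) where
  le := Quotient.lift₂ (faceLE G c) (by
    rintro p q p' q' ⟨hp1, hp2⟩ ⟨hq1, hq2⟩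
    ext
    constructor
    · rintro ⟨hsub, hreach⟩
      constructor
      · rw [← hp1, ← hq1]; exact hsub
      · rw [← hq1]
        have h1 : cEquiv G c q.1 p'.2 p.2 := cEquiv_mono G c hsub (hp1 ▸ hp2.symm)
        exact (h1.trans hreach).trans hq2
    · rintro ⟨hsub, hreach⟩
      constructor
      · rw [hp1, hq1]; exact hsub
      · rw [hq1]
        have h2 : cEquiv G c q'.1 p.2 p'.2 := by
          refine cEquiv_mono G c ?_ hp2
          rw [hp1]; exact hsub
        refine (h2.trans hreach).trans ?_
        rw [hq1] at hq2
        exact hq2.symm)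
  le_refl := by
    refine Quotient.ind (fun p => ?_)
    exact ⟨subset_rfl, SimpleGraph.Reachable.refl _⟩
  le_trans := by
    refine Quotient.ind fun p => Quotient.ind fun q => Quotient.ind fun u => ?_
    rintro ⟨h1, h2⟩ ⟨h3, h4⟩
    exact ⟨h1.trans h3, (cEquiv_mono G c h3 h2).trans h4⟩
  le_antisymm := by
    refine Quotient.ind fun p => Quotient.ind fun q => ?_
    rintro ⟨h1, h2⟩ ⟨h3, h4⟩
    exact Quotient.sound ⟨subset_antisymm h1 h3, subset_antisymm h3 h1 ▸ h2⟩

/-- The rank of a face of `P_G`. -/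
def faceRank (G : SimpleGraph V) (c : V → V → R) : ColorfulFace G c → ℕ :=
  Quotient.lift (fun p => p.1.card) (fun p q h => by
    show p.1.card = q.1.card
    rw [(h.1 : p.1 = q.1)])

/-- A graph automorphism `γ` of `G` is color respecting if any two edges with the same
color are mapped to edges with the same color. -/
def ColorResp {V R : Type*} (G : SimpleGraph V) (c : V → V → R) (γ : G ≃g G) : Prop :=
  ∀ v w v' w' : V, G.Adj v w → G.Adj v' w' → c v w = c v' w' →
    c (γ v) (γ w) = c (γ v') (γ w')

lemma mkFace_eq_mkFace_iff {G : SimpleGraph V} {c : V → V → R} {C D : Finset R} {v w : V} :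
    mkFace G c C v = mkFace G c D w ↔ C = D ∧ cEquiv G c C v w :=
  ⟨fun h => Quotient.exact h, fun h => Quotient.sound h⟩

lemma cEquiv_empty_iff {G : SimpleGraph V} {c : V → V → R} {v w : V} :
    cEquiv G c ∅ v w ↔ v = w := by
  have h : colorSub G c ∅ = ⊥ := by
    ext a b
    simp [colorSub]
  rw [cEquiv, h, SimpleGraph.reachable_bot]

/-- A graph automorphism acting on colors by `σ` restricts to an isomorphism from the subgraph
with colors in `C` onto the subgraph with colors in `σ(C)`. -/
def colorSubIso [DecidableEq R] {G : SimpleGraph V} {c : V → V → R} (γ : G ≃g G)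
    (σ : Equiv.Perm R) (hσ : ∀ v w : V, G.Adj v w → c (γ v) (γ w) = σ (c v w))
    (C : Finset R) : colorSub G c C ≃g colorSub G c (C.image σ) where
  toEquiv := γ.toEquiv
  map_rel_iff' := by
    have key : ∀ a b : V, (G.Adj (γ a) (γ b) ∧ c (γ a) (γ b) ∈ C.image σ) ↔
        (G.Adj a b ∧ c a b ∈ C) := by
      intro a b
      rw [γ.map_adj_iff]
      refine and_congr_right fun h => ?_
      rw [hσ a b h]
      exact σ.injective.mem_finset_image
    intro a b
    exact and_congr (γ.injective.ne_iff) (or_congr (key a b) (key b a))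

lemma cEquiv_image_iff [DecidableEq R] {G : SimpleGraph V} {c : V → V → R} (γ : G ≃g G)
    (σ : Equiv.Perm R) (hσ : ∀ v w : V, G.Adj v w → c (γ v) (γ w) = σ (c v w))
    (C : Finset R) (v w : V) : cEquiv G c (C.image σ) (γ v) (γ w) ↔ cEquiv G c C v w :=
  (colorSubIso γ σ hσ C).reachable_iff

/-- The order automorphism `(C, v) ↦ (σ(C), γ(v))` of the colorful polytope. -/
noncomputable def faceOrderIso [DecidableEq R] {G : SimpleGraph V} {c : V → V → R} (γ : G ≃g G)
    (σ : Equiv.Perm R) (hσ : ∀ v w : V, G.Adj v w → c (γ v) (γ w) = σ (c v w)) :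
    ColorfulFace G c ≃o ColorfulFace G c :=
  RelIso.ofSurjective
    (OrderEmbedding.ofMapLEIff
      (Quotient.lift (fun p : Finset R × V => mkFace G c (p.1.image σ) (γ p.2))
        fun p q ⟨h₁, h₂⟩ => mkFace_eq_mkFace_iff.2
          ⟨congrArg (Finset.image σ) h₁, (cEquiv_image_iff γ σ hσ _ _ _).2 h₂⟩)
      (Quotient.ind fun p => Quotient.ind fun q => and_congr
        (Finset.image_subset_image_iff σ.injective) (cEquiv_image_iff γ σ hσ _ _ _)))
    (Quotient.ind fun p => ⟨mkFace G c (p.1.image σ.symm) (γ.symm p.2), by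
      change mkFace G c ((p.1.image σ.symm).image σ) (γ (γ.symm p.2)) = mkFace G c p.1 p.2
      rw [Finset.image_image, Equiv.self_comp_symm, Finset.image_id, RelIso.apply_symm_apply]⟩)

lemma faceOrderIso_mkFace [DecidableEq R] {G : SimpleGraph V} {c : V → V → R} (γ : G ≃g G)
    (σ : Equiv.Perm R) (hσ : ∀ v w : V, G.Adj v w → c (γ v) (γ w) = σ (c v w))
    (C : Finset R) (v : V) :
    faceOrderIso γ σ hσ (mkFace G c C v) = mkFace G c (C.image σ) (γ v) :=
  rfl

/-- every color respecting automorphism `γ` of `G`, with induced color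
permutation `σ`, induces a well-defined order automorphism `γ̂` of `P_G` with
`γ̂((C,v)) = (σ(C), γ(v))` (and `γ̂` is uniquely determined by this); the map
`μ : γ ↦ γ̂` is an injective group homomorphism `Γ_c(G) → Aut(P_G)`. -/
theorem colorful_mu_injective_homomorphism
    {V R : Type*} [Fintype V] [Fintype R] [DecidableEq R]
    (G : SimpleGraph V) (hconn : G.Connected) (c : V → V → R)
    (hc : IsProperColoring G c) :
    (∀ (γ : G ≃g G) (σ : Equiv.Perm R), ColorResp G c γ →
      (∀ v w : V, G.Adj v w → c (γ v) (γ w) = σ (c v w)) →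
      ∃! e : ColorfulFace G c ≃o ColorfulFace G c,
        ∀ (C : Finset R) (v : V), e (mkFace G c C v) = mkFace G c (C.image σ) (γ v)) ∧
    (∀ (γ : G ≃g G) (σ : Equiv.Perm R), ColorResp G c γ →
      (∀ v w : V, G.Adj v w → c (γ v) (γ w) = σ (c v w)) →
      (∀ (C : Finset R) (v : V), mkFace G c (C.image σ) (γ v) = mkFace G c C v) →
      ∀ v : V, γ v = v) ∧
    (∀ (γ₁ γ₂ : G ≃g G) (σ₁ σ₂ : Equiv.Perm R),
      ColorResp G c γ₁ → ColorResp G c γ₂ →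
      (∀ v w : V, G.Adj v w → c (γ₁ v) (γ₁ w) = σ₁ (c v w)) →
      (∀ v w : V, G.Adj v w → c (γ₂ v) (γ₂ w) = σ₂ (c v w)) →
      ∀ e₁ e₂ e₃ : ColorfulFace G c ≃o ColorfulFace G c,
        (∀ (C : Finset R) (v : V), e₁ (mkFace G c C v) = mkFace G c (C.image σ₁) (γ₁ v)) →
        (∀ (C : Finset R) (v : V), e₂ (mkFace G c C v) = mkFace G c (C.image σ₂) (γ₂ v)) →
        (∀ (C : Finset R) (v : V),
          e₃ (mkFace G c C v) = mkFace G c (C.image (σ₁ * σ₂)) (γ₁ (γ₂ v))) →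
        ∀ x : ColorfulFace G c, e₃ x = e₁ (e₂ x)) := by
  refine ⟨fun γ σ _ hσ => ?_, fun γ σ _ _ h v => ?_, ?_⟩
  · refine ⟨faceOrderIso γ σ hσ, faceOrderIso_mkFace γ σ hσ, fun e he => ?_⟩
    ext x
    induction x using Quotient.ind with
    | _ p => exact he p.1 p.2
  · exact cEquiv_empty_iff.1 (mkFace_eq_mkFace_iff.1 (h ∅ v)).2
  · intro γ₁ γ₂ σ₁ σ₂ _ _ _ _ e₁ e₂ e₃ h₁ h₂ h₃
    refine Quotient.ind fun p => ?_
    change e₃ (mkFace G c p.1 p.2) = e₁ (e₂ (mkFace G c p.1 p.2))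
    rw [h₃, h₂, h₁, Finset.image_image, Equiv.Perm.coe_mul]
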